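/- Let D, R be real symmetric PSD p×p Laplacians and Γ = schur(D+jR, q) with (D+jR)[I_q;E] = [Γ;0]. If ȳ ∈ ℂ^q is a unit eigenvector of Γ with purely imaginary eigenvalue jμ (μ ∈ ℝ), then, setting ḡ = Eȳ and ζ = [ȳ; ḡ], one has D ζ = 0 and R ζ = [μ ȳ; 0]. -/

import Mathlib

open Matrix ComplexOrder MatrixOrder in
theorem Matrix.PosSemidef.map_complexOfReal {n : Type*} [Fintype n] {A : Matrix n n ℝ}
    (hA : A.PosSemidef) : (A.map Complex.ofReal).PosSemidef := by
  classical
  obtain ⟨B, rfl⟩ := CStarAlgebra.nonneg_iff_eq_star_mul_self.mp hA.nonneg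
  have hB : (star B * B).map Complex.ofReal =
      (B.map Complex.ofReal)ᴴ * B.map Complex.ofReal := by
    ext i j
    simp [Matrix.mul_apply, Matrix.star_eq_conjTranspose]
  rw [hB]
  exact posSemidef_conjTranspose_mul_self _

open Matrix in
theorem imaginary_eigenvector_gives_static_constraints
    (q r : ℕ)
    (D R : Matrix (Fin q ⊕ Fin r) (Fin q ⊕ Fin r) ℝ)
    (hD : D.PosSemidef) (hR : R.PosSemidef)
    (hD1 : D.mulVec (fun _ => 1) = 0) (hR1 : R.mulVec (fun _ => 1) = 0)
    (E : Matrix (Fin r) (Fin q) ℂ)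
    (Γ : Matrix (Fin q) (Fin q) ℂ)
    (h : (D.map Complex.ofReal + Complex.I • R.map Complex.ofReal) *
          Matrix.fromBlocks 1 0 E 0 = Matrix.fromBlocks Γ 0 0 0)
    (y : Fin q → ℂ) (hunit : star y ⬝ᵥ y = 1)
    (μ : ℝ) (heig : Γ.mulVec y = (Complex.I * μ) • y) :
    (D.map Complex.ofReal).mulVec (Sum.elim y (E.mulVec y)) = 0 ∧
      (R.map Complex.ofReal).mulVec (Sum.elim y (E.mulVec y)) =
        Sum.elim ((μ : ℂ) • y) 0 := by
  have hDc := hD.map_complexOfReal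
  have hRc := hR.map_complexOfReal
  set ζ : Fin q ⊕ Fin r → ℂ := Sum.elim y (E.mulVec y) with hζ
  have hsum : D.map Complex.ofReal *ᵥ ζ + Complex.I • (R.map Complex.ofReal *ᵥ ζ) =
      Complex.I • Sum.elim ((μ : ℂ) • y) 0 := by
    have hv := congrArg (fun M => M *ᵥ Sum.elim y 0) h
    simp only [← mulVec_mulVec, fromBlocks_mulVec, Sum.elim_comp_inl, Sum.elim_comp_inr,
      one_mulVec, mulVec_zero, zero_mulVec, add_zero, heig, add_mulVec, smul_mulVec] at hv
    rw [hζ, hv]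
    ext (i | i) <;> simp [mul_assoc]
  have hquad : star ζ ⬝ᵥ (D.map Complex.ofReal *ᵥ ζ) +
      Complex.I * (star ζ ⬝ᵥ (R.map Complex.ofReal *ᵥ ζ)) = Complex.I * μ := by
    have hy : star ζ ⬝ᵥ Sum.elim ((μ : ℂ) • y) 0 = μ := by
      have hstar : star ζ = Sum.elim (star y) (star (E *ᵥ y)) := by
        ext (i | i) <;> simp [hζ]
      rw [hstar, sumElim_dotProduct_sumElim, dotProduct_smul, hunit]
      simp
    have := congrArg (star ζ ⬝ᵥ ·) hsum
    simpa only [dotProduct_add, dotProduct_smul, hy, smul_eq_mul] using this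
  have hDim :=
    open scoped ComplexOrder in hDc.isHermitian.im_star_dotProduct_mulVec_self ζ
  have hRim :=
    open scoped ComplexOrder in hRc.isHermitian.im_star_dotProduct_mulVec_self ζ
  simp only [RCLike.im_to_complex] at hDim hRim
  have hD0 : D.map Complex.ofReal *ᵥ ζ = 0 := by
    refine (open scoped ComplexOrder in hDc.dotProduct_mulVec_zero_iff ζ).mp ?_
    refine Complex.ext ?_ (by simpa using hDim)
    simpa [hRim] using congrArg Complex.re hquad
  refine ⟨hD0, ?_⟩
  rw [hD0, zero_add] at hsum
  exact smul_right_injective _ Complex.I_ne_zero hsum
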